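/- arXiv:2109.10454 — 2 statements merged into one kernel-verified Lean document; each statement's English description precedes it below -/
import Mathlib

section
/- Let r ≥ 2, let κ divide d with d' = d/κ, and suppose each A_i ∈ ℝ^{m×n^κ} (i = 1,…,d') satisfies RIP(ε, S_{1,2}), where δ := 12 d' r^d ε < 1. Let A_2nd be a matrix with m^{d'} columns, and define 𝒜_2nd(X) := A_2nd(vect(𝒜(R(X)))). Assume A_2nd ∘ vect satisfies RIP(δ/3, B_{1+ε, ε, 1−δ/3, (r^κ,…,r^κ)}), where B_{1+ε, ε, 1−δ/3, (r^κ,…,r^κ)} is taken inside d'-mode tensors with side length m. Then 𝒜_2nd satisfies TRIP(δ,(r,…,r)): (1−δ)‖X‖_F² ≤ ‖𝒜_2nd(X)‖² ≤ (1+δ)‖X‖_F² for every d-mode tensor X with side length n of HOSVD rank at most (r,…,r). -/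
open Finset

noncomputable section

/-- Squared Euclidean (Frobenius) norm of a finitely-indexed real vector/tensor. -/
def enorm2 {ι : Type*} [Fintype ι] (x : ι → ℝ) : ℝ := ∑ i, (x i) ^ 2

/-- Euclidean (trace) inner product. -/
def dotp {ι : Type*} [Fintype ι] (x y : ι → ℝ) : ℝ := ∑ i, x i * y i

/-- Kronecker product of `κ` vectors in `ℝ^n`, as a vector in `ℝ^{n^κ}`
(identifying `ℝ^{n^κ}` with `(Fin κ → Fin n) → ℝ` lexicographically). -/
def kron {n κ : ℕ} (u : Fin κ → (Fin n → ℝ)) : Fin (n ^ κ) → ℝ :=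
  fun j => ∏ i, u i (finFunctionFinEquiv.symm j i)

/-- `S₁`: Kronecker products of `κ` unit vectors of `ℝ^n`. -/
def S1 (n κ : ℕ) : Set (Fin (n ^ κ) → ℝ) :=
  {x | ∃ u : Fin κ → (Fin n → ℝ), (∀ i, enorm2 (u i) = 1) ∧ x = kron u}

/-- `S₂`: normalized sums of two orthogonal elements of `S₁`. -/
def S2 (n κ : ℕ) : Set (Fin (n ^ κ) → ℝ) :=
  {z | ∃ x ∈ S1 n κ, ∃ y ∈ S1 n κ, dotp x y = 0 ∧
        z = (Real.sqrt (enorm2 (x + y)))⁻¹ • (x + y)}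

/-- `S_{1,2} = S₁ ∪ S₂`. -/
def S12 (n κ : ℕ) : Set (Fin (n ^ κ) → ℝ) := S1 n κ ∪ S2 n κ

/-- The matrix `A` satisfies RIP(ε, S): `(1-ε)‖s‖² ≤ ‖As‖² ≤ (1+ε)‖s‖²` for all `s ∈ S`. -/
def MatrixRIP {m N : ℕ} (A : Matrix (Fin m) (Fin N) ℝ) (ε : ℝ) (S : Set (Fin N → ℝ)) : Prop :=
  ∀ s ∈ S, (1 - ε) * enorm2 s ≤ enorm2 (A.mulVec s) ∧
    enorm2 (A.mulVec s) ≤ (1 + ε) * enorm2 s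

/-- Index identification merging each block of `κ` consecutive indices (block `i` of the
original `d = κ·d'` indices becomes mode `i` of the reshaped tensor, merged lexicographically). -/
def reshapeIdx (n κ d' : ℕ) : (Fin (κ * d') → Fin n) ≃ (Fin d' → Fin (n ^ κ)) :=
  (Equiv.arrowCongr ((finCongr (Nat.mul_comm κ d')).trans finProdFinEquiv.symm)
      (Equiv.refl (Fin n))).trans
    ((Equiv.curry (Fin d') (Fin κ) (Fin n)).trans
      (Equiv.piCongrRight fun _ => finFunctionFinEquiv))

/-- The reshaping operator `R` turning a `d = κ·d'`-mode tensor with side length `n`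
into a `d'`-mode tensor with side length `n^κ`. -/
def reshape (n κ d' : ℕ) (X : (Fin (κ * d') → Fin n) → ℝ) : (Fin d' → Fin (n ^ κ)) → ℝ :=
  fun j => X ((reshapeIdx n κ d').symm j)

/-- The modewise measurement map `𝒜(Y) = Y ×₁ A₁ ×₂ ⋯ ×_{d'} A_{d'}`. -/
def modewiseAll {d' N m : ℕ} (A : Fin d' → Matrix (Fin m) (Fin N) ℝ)
    (Y : (Fin d' → Fin N) → ℝ) : (Fin d' → Fin m) → ℝ :=
  fun ℓ => ∑ j : Fin d' → Fin N, Y j * ∏ i, A i (ℓ i) (j i)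

/-- `X` has HOSVD rank at most `(r, …, r)`: it is expressible with a core tensor `C` and
orthonormal factor vectors `u^i_1, …, u^i_r` in each mode. -/
def HOSVDRankLE (d n r : ℕ) (X : (Fin d → Fin n) → ℝ) : Prop :=
  ∃ (C : (Fin d → Fin r) → ℝ) (u : Fin d → Fin r → (Fin n → ℝ)),
    (∀ i k, enorm2 (u i k) = 1) ∧
    (∀ i k k', k ≠ k' → dotp (u i k) (u i k') = 0) ∧
    (∀ t, X t = ∑ k : Fin d → Fin r, C k * ∏ i, u i (k i) (t i))

/-- Vectorization of a `d'`-mode tensor with side length `m` into `ℝ^{m^{d'}}`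
(via the lexicographic index bijection). -/
def vect {d' m : ℕ} (Y : (Fin d' → Fin m) → ℝ) : Fin (m ^ d') → ℝ :=
  fun j => Y (finFunctionFinEquiv.symm j)

end

/-- The set `B_{R,μ,θ,(ρ,…,ρ)}` of nearly orthogonal `d'`-mode tensors with side length `m`:
tensors representable as `Z(t) = Σ_k C(k) ∏ᵢ wⁱ_{kᵢ}(tᵢ)` where (a) `‖wⁱ_k‖₂ ≤ R`,
(b) `|⟨wⁱ_k, wⁱ_{k'}⟩| ≤ μ` for `k ≠ k'`, (c) `‖C‖_F = 1`, (d) `C` has orthogonal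
subtensors, and (e) `‖Z‖_F ≥ θ`. -/
def BSet (d' m ρ : ℕ) (R μ θ : ℝ) : Set ((Fin d' → Fin m) → ℝ) :=
  {Z | ∃ (C : (Fin d' → Fin ρ) → ℝ) (w : Fin d' → Fin ρ → (Fin m → ℝ)),
    (∀ i k, Real.sqrt (enorm2 (w i k)) ≤ R) ∧
    (∀ i k k', k ≠ k' → |dotp (w i k) (w i k')| ≤ μ) ∧
    enorm2 C = 1 ∧
    (∀ (i : Fin d') (p q : Fin ρ), p ≠ q →
      (∑ k : Fin d' → Fin ρ, if k i = p then C k * C (Function.update k i q) else 0) = 0) ∧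
    θ ≤ Real.sqrt (enorm2 Z) ∧
    (∀ t, Z t = ∑ k : Fin d' → Fin ρ, C k * ∏ i, w i (k i) (t i))}

lemma enorm2_eq_dotp {ι : Type*} [Fintype ι] (x : ι → ℝ) : enorm2 x = dotp x x := by
  simp [enorm2, dotp, sq]

lemma enorm2_smul {ι : Type*} [Fintype ι] (c : ℝ) (x : ι → ℝ) :
    enorm2 (c • x) = c ^ 2 * enorm2 x := by
  simp [enorm2, mul_pow, Finset.mul_sum]

lemma enorm2_nonneg {ι : Type*} [Fintype ι] (x : ι → ℝ) : 0 ≤ enorm2 x :=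
  Finset.sum_nonneg fun _ _ => sq_nonneg _

lemma enorm2_eq_zero {ι : Type*} [Fintype ι] {x : ι → ℝ} (h : enorm2 x = 0) : x = 0 := by
  funext i
  have := (Finset.sum_eq_zero_iff_of_nonneg (fun j _ => sq_nonneg (x j))).1 h i (mem_univ i)
  simpa using this

lemma enorm2_add {ι : Type*} [Fintype ι] (x y : ι → ℝ) :
    enorm2 (x + y) = enorm2 x + 2 * dotp x y + enorm2 y := by
  simp only [enorm2, dotp, Finset.mul_sum, ← Finset.sum_add_distrib, Pi.add_apply]
  exact Finset.sum_congr rfl fun _ _ => by ring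

lemma dotp_neg_right {ι : Type*} [Fintype ι] (x y : ι → ℝ) : dotp x (-y) = -dotp x y := by
  simp [dotp]

lemma enorm2_neg {ι : Type*} [Fintype ι] (x : ι → ℝ) : enorm2 (-x) = enorm2 x := by
  simp [enorm2]

/-- The tensor `Σ_k C(k) ∏ᵢ wⁱ_{kᵢ}` with core `C` and factors `w`. -/
def tucker {ι J T : Type*} [Fintype ι] [DecidableEq ι] [Fintype J]
    (C : (ι → J) → ℝ) (w : ι → J → T → ℝ) : (ι → T) → ℝ :=
  fun t => ∑ k, C k * ∏ i, w i (k i) (t i)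

lemma sum_prod_mul_prod {ι T : Type*} [Fintype ι] [DecidableEq ι] [Fintype T]
    (f g : ι → T → ℝ) :
    ∑ t : ι → T, (∏ i, f i (t i)) * ∏ i, g i (t i) = ∏ i, dotp (f i) (g i) := by
  simp only [dotp, ← Finset.prod_mul_distrib, Finset.prod_univ_sum, Fintype.piFinset_univ]

lemma enorm2_tucker {ι J T : Type*} [Fintype ι] [DecidableEq ι] [Fintype J] [Fintype T]
    (C : (ι → J) → ℝ) (w : ι → J → T → ℝ) :
    enorm2 (tucker C w) =
      ∑ k, ∑ l, C k * C l * ∏ i, dotp (w i (k i)) (w i (l i)) := by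
  simp only [enorm2_eq_dotp, ← sum_prod_mul_prod]
  simp only [dotp, tucker]
  simp_rw [Finset.sum_mul_sum]
  rw [Finset.sum_comm]
  refine Finset.sum_congr rfl fun k _ => ?_
  rw [Finset.sum_comm]
  refine Finset.sum_congr rfl fun l _ => ?_
  rw [Finset.mul_sum]
  exact Finset.sum_congr rfl fun t _ => by ring

lemma abs_prod_sub_prod_le {ι : Type*} (s : Finset ι) (a b : ι → ℝ) {ε : ℝ} (hε : 0 ≤ ε)
    (hb : ∀ i, |b i| ≤ 1) (hab : ∀ i, |a i - b i| ≤ ε) :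
    |∏ i ∈ s, a i - ∏ i ∈ s, b i| ≤ (1 + ε) ^ s.card - 1 := by
  classical
  induction s using Finset.induction_on with
  | empty => simp
  | insert j s hj ih =>
    rw [Finset.prod_insert hj, Finset.prod_insert hj, Finset.card_insert_of_notMem hj]
    have ha : |a j| ≤ 1 + ε := by
      have := abs_add_le (b j) (a j - b j)
      rw [add_sub_cancel] at this
      linarith [hb j, hab j]
    have hP : |∏ i ∈ s, b i| ≤ 1 := by
      rw [Finset.abs_prod]
      exact Finset.prod_le_one (fun _ _ => abs_nonneg _) fun i _ => hb i
    calc |a j * ∏ i ∈ s, a i - b j * ∏ i ∈ s, b i|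
        = |a j * (∏ i ∈ s, a i - ∏ i ∈ s, b i) + (a j - b j) * ∏ i ∈ s, b i| := by ring_nf
      _ ≤ |a j| * |∏ i ∈ s, a i - ∏ i ∈ s, b i| + |a j - b j| * |∏ i ∈ s, b i| := by
        rw [← abs_mul, ← abs_mul]
        exact abs_add_le _ _
      _ ≤ (1 + ε) * ((1 + ε) ^ s.card - 1) + ε * 1 := by
        gcongr
        exact hab j
      _ = (1 + ε) ^ (s.card + 1) - 1 := by ring

lemma abs_enorm2_tucker_sub_le {ι J T : Type*} [Fintype ι] [DecidableEq ι] [Fintype J]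
    [DecidableEq J] [Fintype T] (C : (ι → J) → ℝ) (w : ι → J → T → ℝ) {ε : ℝ} (hε : 0 ≤ ε)
    (hw : ∀ i x y, |dotp (w i x) (w i y) - if x = y then 1 else 0| ≤ ε) :
    |enorm2 (tucker C w) - enorm2 C| ≤
      ((1 + ε) ^ Fintype.card ι - 1) * Fintype.card (ι → J) * enorm2 C := by
  have hC : enorm2 C =
      ∑ k, ∑ l, C k * C l * ∏ i, if k i = l i then (1 : ℝ) else 0 := by
    simp [enorm2, Fintype.prod_boole, ← funext_iff, sq]
  have hη : (0 : ℝ) ≤ (1 + ε) ^ Fintype.card ι - 1 :=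
    sub_nonneg.2 (one_le_pow₀ (by linarith))
  have hsq : (∑ k, |C k|) ^ 2 ≤ Fintype.card (ι → J) * enorm2 C := by
    simpa [enorm2] using sq_sum_le_card_mul_sum_sq (s := univ) (f := fun k => |C k|)
  calc |enorm2 (tucker C w) - enorm2 C|
      = |∑ k, ∑ l, C k * C l * (∏ i, dotp (w i (k i)) (w i (l i)) -
          ∏ i, if k i = l i then (1 : ℝ) else 0)| := by
        rw [enorm2_tucker, hC]
        simp only [← Finset.sum_sub_distrib, mul_sub]
    _ ≤ ∑ k, ∑ l, |C k| * |C l| * ((1 + ε) ^ Fintype.card ι - 1) := by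
        refine (Finset.abs_sum_le_sum_abs _ _).trans (Finset.sum_le_sum fun k _ => ?_)
        refine (Finset.abs_sum_le_sum_abs _ _).trans (Finset.sum_le_sum fun l _ => ?_)
        rw [abs_mul, abs_mul]
        gcongr
        refine abs_prod_sub_prod_le univ _ _ hε (fun i => ?_) fun i => hw i _ _
        split_ifs <;> simp
    _ = ((1 + ε) ^ Fintype.card ι - 1) * (∑ k, |C k|) ^ 2 := by
        rw [sq, Finset.sum_mul_sum, Finset.mul_sum]
        refine Finset.sum_congr rfl fun k _ => ?_
        rw [Finset.mul_sum]
        exact Finset.sum_congr rfl fun l _ => by ring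
    _ ≤ _ := by
        rw [mul_assoc]
        gcongr

lemma enorm2_tucker_of_orthonormal {ι J T : Type*} [Fintype ι] [DecidableEq ι] [Fintype J]
    [DecidableEq J] [Fintype T] (C : (ι → J) → ℝ) (w : ι → J → T → ℝ)
    (hw : ∀ i x y, dotp (w i x) (w i y) = if x = y then 1 else 0) :
    enorm2 (tucker C w) = enorm2 C := by
  have := abs_enorm2_tucker_sub_le C w le_rfl fun i x y => by rw [hw]; simp
  simpa [sub_eq_zero] using this

lemma dotp_kron {n κ : ℕ} (u v : Fin κ → Fin n → ℝ) :
    dotp (kron u) (kron v) = ∏ a, dotp (u a) (v a) := by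
  rw [← sum_prod_mul_prod, dotp]
  exact Equiv.sum_comp finFunctionFinEquiv.symm
    fun t : Fin κ → Fin n => (∏ i, u i (t i)) * ∏ i, v i (t i)

lemma neg_mem_S1 {n κ : ℕ} (hκ : 1 ≤ κ) {x : Fin (n ^ κ) → ℝ} (hx : x ∈ S1 n κ) :
    -x ∈ S1 n κ := by
  obtain ⟨u, hu, rfl⟩ := hx
  refine ⟨Function.update u ⟨0, hκ⟩ (-u ⟨0, hκ⟩), fun i => ?_, ?_⟩
  · by_cases h : i = ⟨0, hκ⟩
    · subst h
      simp [enorm2_neg, hu]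
    · simp [h, hu]
  · funext j
    simp only [kron, Pi.neg_apply]
    rw [← Finset.mul_prod_erase univ _ (mem_univ (⟨0, hκ⟩ : Fin κ)),
      ← Finset.mul_prod_erase univ (fun i => Function.update u _ _ i _)
        (mem_univ (⟨0, hκ⟩ : Fin κ)), Function.update_self, Pi.neg_apply, neg_mul]
    congr 2
    refine Finset.prod_congr rfl fun i hi => ?_
    rw [Function.update_of_ne (Finset.ne_of_mem_erase hi)]

lemma enorm2_of_mem_S1 {n κ : ℕ} {x : Fin (n ^ κ) → ℝ} (hx : x ∈ S1 n κ) : enorm2 x = 1 := by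
  obtain ⟨u, hu, rfl⟩ := hx
  rw [enorm2_eq_dotp, dotp_kron]
  exact Finset.prod_eq_one fun i _ => by rw [← enorm2_eq_dotp, hu]

lemma MatrixRIP.enorm2_add {m n κ : ℕ} {A : Matrix (Fin m) (Fin (n ^ κ)) ℝ} {ε : ℝ}
    (hA : MatrixRIP A ε (S12 n κ)) {x y : Fin (n ^ κ) → ℝ} (hx : x ∈ S1 n κ)
    (hy : y ∈ S1 n κ) (hxy : dotp x y = 0) :
    2 * (1 - ε) ≤ enorm2 (A.mulVec x + A.mulVec y) ∧
      enorm2 (A.mulVec x + A.mulVec y) ≤ 2 * (1 + ε) := by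
  have h2 : enorm2 (x + y) = 2 := by
    rw [_root_.enorm2_add, enorm2_of_mem_S1 hx, enorm2_of_mem_S1 hy, hxy]
    norm_num
  have h := hA _ (Or.inr ⟨x, hx, y, hy, hxy, rfl⟩)
  have hs : ((Real.sqrt 2)⁻¹) ^ 2 = (1 / 2 : ℝ) := by
    rw [inv_pow, Real.sq_sqrt (by norm_num)]
    norm_num
  rw [Matrix.mulVec_smul, enorm2_smul, enorm2_smul, h2, hs, Matrix.mulVec_add] at h
  constructor <;> linarith [h.1, h.2]

lemma MatrixRIP.abs_dotp_le {m n κ : ℕ} (hκ : 1 ≤ κ) {A : Matrix (Fin m) (Fin (n ^ κ)) ℝ}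
    {ε : ℝ} (hA : MatrixRIP A ε (S12 n κ)) {x y : Fin (n ^ κ) → ℝ} (hx : x ∈ S1 n κ)
    (hy : y ∈ S1 n κ) (hxy : dotp x y = 0) : |dotp (A.mulVec x) (A.mulVec y)| ≤ ε := by
  have h₁ := hA.enorm2_add hx hy hxy
  have h₂ := hA.enorm2_add hx (neg_mem_S1 hκ hy) (by rw [dotp_neg_right, hxy, neg_zero])
  rw [_root_.enorm2_add] at h₁ h₂
  rw [Matrix.mulVec_neg, dotp_neg_right, enorm2_neg] at h₂
  rw [abs_le]
  constructor <;> linarith [h₁.1, h₁.2, h₂.1, h₂.2]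

lemma modewiseAll_tucker {d' N m : ℕ} {J : Type*} [Fintype J]
    (A : Fin d' → Matrix (Fin m) (Fin N) ℝ) (C : (Fin d' → J) → ℝ)
    (w : Fin d' → J → Fin N → ℝ) :
    modewiseAll A (tucker C w) = tucker C fun i x => (A i).mulVec (w i x) := by
  funext ℓ
  simp only [modewiseAll, tucker, Finset.sum_mul]
  rw [Finset.sum_comm]
  refine Finset.sum_congr rfl fun k _ => ?_
  have := sum_prod_mul_prod (fun i => A i (ℓ i)) fun i => w i (k i)
  change _ = C k * ∏ i, dotp (A i (ℓ i)) (w i (k i))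
  rw [← this, Finset.mul_sum]
  exact Finset.sum_congr rfl fun j _ => by ring

lemma enorm2_reshape {n κ d' : ℕ} (X : (Fin (κ * d') → Fin n) → ℝ) :
    enorm2 (reshape n κ d' X) = enorm2 X :=
  Equiv.sum_comp (reshapeIdx n κ d').symm fun j => X j ^ 2

/-- Position in `Fin (κ * d')` of the `a`-th index of the `i`-th block. -/
def blockIdx (κ d' : ℕ) (i : Fin d') (a : Fin κ) : Fin (κ * d') :=
  ((finCongr (Nat.mul_comm κ d')).trans finProdFinEquiv.symm).symm (i, a)

lemma reshapeIdx_symm_blockIdx (n κ d' : ℕ) (j : Fin d' → Fin (n ^ κ)) (i : Fin d')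
    (a : Fin κ) :
    (reshapeIdx n κ d').symm j (blockIdx κ d' i a) = finFunctionFinEquiv.symm (j i) a := by
  simp [reshapeIdx, blockIdx, Equiv.arrowCongr]

lemma reshape_tucker {n κ d' r : ℕ} (C : (Fin (κ * d') → Fin r) → ℝ)
    (u : Fin (κ * d') → Fin r → Fin n → ℝ) :
    reshape n κ d' (tucker C u) = tucker (reshape r κ d' C) fun i p =>
      kron fun a => u (blockIdx κ d' i a) (finFunctionFinEquiv.symm p a) := by
  funext j
  simp only [reshape, tucker, kron]
  rw [← Equiv.sum_comp (reshapeIdx r κ d').symm]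
  refine Finset.sum_congr rfl fun k _ => ?_
  congr 1
  rw [← Equiv.prod_comp ((finCongr (Nat.mul_comm κ d')).trans finProdFinEquiv.symm).symm,
    Fintype.prod_prod_type]
  refine Finset.prod_congr rfl fun i _ => Finset.prod_congr rfl fun a _ => ?_
  rw [← reshapeIdx_symm_blockIdx, ← reshapeIdx_symm_blockIdx]
  rfl

lemma tucker_tucker {ι J T S : Type*} [Fintype ι] [DecidableEq ι] [Fintype J] [Fintype T]
    (C : (ι → J) → ℝ) (v : ι → J → T → ℝ) (w : ι → T → S → ℝ) :
    tucker (tucker C v) w = tucker C fun i x s => ∑ a, v i x a * w i a s := by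
  funext s
  simp only [tucker, Finset.sum_mul]
  rw [Finset.sum_comm]
  refine Finset.sum_congr rfl fun k _ => ?_
  rw [Finset.prod_univ_sum, Fintype.piFinset_univ, Finset.mul_sum]
  refine Finset.sum_congr rfl fun t _ => ?_
  rw [Finset.prod_mul_distrib]
  ring

lemma tucker_one {ι T : Type*} [Fintype ι] [DecidableEq ι] [Fintype T] [DecidableEq T]
    (C : (ι → T) → ℝ) : tucker C (fun _ s t => if s = t then 1 else 0) = C := by
  funext t
  simp [tucker, Fintype.prod_boole, ← funext_iff]

/-- The matrix of inner products of the mode-`i` slices of a tensor. -/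
def modeGram {ι J : Type*} [Fintype ι] [DecidableEq ι] [Fintype J] [DecidableEq J]
    (Z : (ι → J) → ℝ) (i : ι) : Matrix J J ℝ :=
  Matrix.of fun p q => ∑ k, if k i = p then Z k * Z (Function.update k i q) else 0

lemma modeGram_isHermitian {ι J : Type*} [Fintype ι] [DecidableEq ι] [Fintype J]
    [DecidableEq J] (Z : (ι → J) → ℝ) (i : ι) : (modeGram Z i).IsHermitian := by
  ext p q
  simp only [Matrix.conjTranspose_apply, star_trivial, modeGram, Matrix.of_apply,
    ← Finset.sum_filter]
  refine Finset.sum_nbij' (fun k => Function.update k i p) (fun k => Function.update k i q)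
    (by simp) (by simp) ?_ ?_ ?_
  all_goals
    simp only [mem_filter, mem_univ, true_and]
    rintro k rfl
    simp [mul_comm]

lemma eq_zero_of_modeGram_self {ι J : Type*} [Fintype ι] [DecidableEq ι] [Fintype J]
    [DecidableEq J] {Z : (ι → J) → ℝ} {i : ι} {k : ι → J}
    (h : modeGram Z i (k i) (k i) = 0) : Z k = 0 := by
  rw [modeGram, Matrix.of_apply, Finset.sum_eq_zero_iff_of_nonneg] at h
  · simpa using h k (mem_univ k)
  · intro l _
    split_ifs with hl
    · rw [← hl, Function.update_eq_self]
      exact mul_self_nonneg _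
    · exact le_rfl

lemma rank_modeGram_tucker_le {ι J T : Type*} [Fintype ι] [DecidableEq ι] [Fintype J]
    [DecidableEq J] [Fintype T] [DecidableEq T] (C : (ι → J) → ℝ) (w : ι → J → T → ℝ)
    (i : ι) : (modeGram (tucker C w) i).rank ≤ Fintype.card J := by
  have hslice : ∀ (s : ι → T) (b : T), tucker C w (Function.update s i b) =
      ∑ x, (∑ k, if k i = x then C k * ∏ j ∈ univ.erase i, w j (k j) (s j) else 0) *
        w i x b := by
    intro s b
    simp only [tucker, Finset.sum_mul]
    rw [Finset.sum_comm]
    refine Finset.sum_congr rfl fun k _ => ?_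
    simp only [ite_mul, zero_mul, Finset.sum_ite_eq, mem_univ, if_true]
    rw [← Finset.mul_prod_erase univ _ (mem_univ i), Function.update_self,
      Finset.prod_congr rfl fun j hj => by
        rw [Function.update_of_ne (Finset.ne_of_mem_erase hj)]]
    ring
  have hfactor : modeGram (tucker C w) i =
      (Matrix.of fun a x => ∑ s : ι → T, if s i = a then tucker C w s *
        ∑ k, if k i = x then C k * ∏ j ∈ univ.erase i, w j (k j) (s j) else 0 else 0) *
      Matrix.of (w i) := by
    ext a b
    simp only [modeGram, Matrix.of_apply, Matrix.mul_apply, Finset.sum_mul]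
    rw [Finset.sum_comm]
    refine Finset.sum_congr rfl fun s _ => ?_
    split_ifs
    · rw [hslice, Finset.mul_sum]
      exact Finset.sum_congr rfl fun x _ => by rw [mul_assoc]
    · simp
  rw [hfactor]
  exact (Matrix.rank_mul_le_right _ _).trans (Matrix.rank_le_card_height _)

lemma modeGram_tucker_of_frame {ι J T : Type*} [Fintype ι] [DecidableEq ι] [Fintype J]
    [DecidableEq J] [Fintype T] [DecidableEq T] (Z : (ι → T) → ℝ) (V : ι → J → T → ℝ)
    (hV : ∀ i s t, ∑ x, V i x s * V i x t = if s = t then 1 else 0) (i : ι) (p q : J) :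
    modeGram (tucker Z fun i t x => V i x t) i p q =
      ∑ a, ∑ b, V i p a * V i q b * modeGram Z i a b := by
  have hprod : ∀ (s t : ι → T) (k : ι → J),
      (if k i = p then (∏ j, V j (k j) (s j)) *
        ∏ j, V j (Function.update k i q j) (t j) else 0) =
      ∏ j, if j = i then (if k j = p then V j p (s j) * V j q (t j) else 0)
        else V j (k j) (s j) * V j (k j) (t j) := by
    intro s t k
    have hupd : ∏ j ∈ univ.erase i, V j (Function.update k i q j) (t j) =
        ∏ j ∈ univ.erase i, V j (k j) (t j) :=
      Finset.prod_congr rfl fun j hj => by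
        rw [Function.update_of_ne (Finset.ne_of_mem_erase hj)]
    have hite : (∏ j ∈ univ.erase i, if j = i then
          (if k j = p then V j p (s j) * V j q (t j) else 0)
          else V j (k j) (s j) * V j (k j) (t j)) =
        (∏ j ∈ univ.erase i, V j (k j) (s j)) * ∏ j ∈ univ.erase i, V j (k j) (t j) := by
      rw [← Finset.prod_mul_distrib]
      exact Finset.prod_congr rfl fun j hj => if_neg (Finset.ne_of_mem_erase hj)
    rw [← Finset.mul_prod_erase univ (fun j => ite _ _ _) (mem_univ i), if_pos rfl,
      ← Finset.mul_prod_erase univ (fun j => V j (k j) (s j)) (mem_univ i),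
      ← Finset.mul_prod_erase univ (fun j => V j (Function.update k i q j) (t j))
        (mem_univ i), Function.update_self, hupd, hite]
    split_ifs with h
    · rw [h]
      ring
    · simp
  have hsum : ∀ s t : ι → T, (∑ k : ι → J, if k i = p then (∏ j, V j (k j) (s j)) *
        ∏ j, V j (Function.update k i q j) (t j) else 0) =
      ∏ j, if j = i then V j p (s j) * V j q (t j) else if s j = t j then 1 else 0 := by
    intro s t
    simp only [hprod]
    have := Finset.prod_univ_sum (fun _ : ι => (univ : Finset J)) fun j x =>
      if j = i then (if x = p then V j p (s j) * V j q (t j) else 0)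
        else V j x (s j) * V j x (t j)
    rw [Fintype.piFinset_univ] at this
    rw [← this]
    refine Finset.prod_congr rfl fun j _ => ?_
    split_ifs with hj hst
    · simp
    · rw [hV, if_pos hst]
    · rw [hV, if_neg hst]
  have hcollapse : ∀ s : ι → T, ∑ t, Z s * Z t *
      (∏ j, if j = i then V j p (s j) * V j q (t j) else if s j = t j then 1 else 0) =
      ∑ b, V i p (s i) * V i q b * (Z s * Z (Function.update s i b)) := by
    intro s
    refine (Fintype.sum_of_injective (Function.update s i) (Function.update_injective s i)
      _ _ (fun t ht => ?_) fun b => ?_).symm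
    · obtain ⟨j, hj, hst⟩ : ∃ j, j ≠ i ∧ s j ≠ t j := by
        by_contra! h
        refine ht ⟨t i, funext fun j => ?_⟩
        by_cases hj : j = i
        · subst hj
          simp
        · rw [Function.update_of_ne hj, h j hj]
      rw [Finset.prod_eq_zero (mem_univ j) (by simp [hj, hst]), mul_zero]
    · rw [Finset.prod_eq_single i (fun j _ hj => by simp [hj]) (by simp), if_pos rfl,
        Function.update_self]
      ring
  calc modeGram (tucker Z fun i t x => V i x t) i p q
      = ∑ k : ι → J, ∑ s, ∑ t, Z s * Z t * (if k i = p then (∏ j, V j (k j) (s j)) *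
          ∏ j, V j (Function.update k i q j) (t j) else 0) := by
        rw [modeGram, Matrix.of_apply]
        refine Finset.sum_congr rfl fun k _ => ?_
        split_ifs
        · rw [tucker, tucker, Finset.sum_mul_sum]
          exact Finset.sum_congr rfl fun s _ => Finset.sum_congr rfl fun t _ => by ring
        · simp
    _ = ∑ s, ∑ b, V i p (s i) * V i q b * (Z s * Z (Function.update s i b)) := by
        rw [Finset.sum_comm]
        refine Finset.sum_congr rfl fun s _ => ?_
        rw [Finset.sum_comm, ← hcollapse]
        refine Finset.sum_congr rfl fun t _ => ?_
        rw [← Finset.mul_sum, hsum]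
    _ = _ := by
        simp only [modeGram, Matrix.of_apply, Finset.mul_sum]
        refine Eq.symm ((Finset.sum_congr rfl fun a _ => Finset.sum_comm).trans ?_)
        rw [Finset.sum_comm]
        refine Finset.sum_congr rfl fun s _ => ?_
        rw [Finset.sum_comm]
        simp

/-- An orthonormal eigenbasis of a symmetric matrix of rank at most `ρ`, padded by zero
vectors, together with `ρ` indices that cover all nonzero eigenvalues. -/
lemma exists_padded_eigenbasis {T : Type*} [Fintype T] [DecidableEq T] {M : Matrix T T ℝ}
    (hM : M.IsHermitian) {ρ : ℕ} (hρ : M.rank ≤ ρ) :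
    ∃ (V : T ⊕ Fin ρ → T → ℝ) (g : Fin ρ → T ⊕ Fin ρ), Function.Injective g ∧
      (∀ s t, ∑ x, V x s * V x t = if s = t then 1 else 0) ∧
      (∀ x, enorm2 (V x) ≤ 1) ∧ (∀ x y, x ≠ y → dotp (V x) (V y) = 0) ∧
      (∀ x y, x ≠ y ∨ x ∉ Set.range g → ∑ a, ∑ b, V x a * V y b * M a b = 0) := by
  set U : T → T → ℝ := fun p => ⇑(hM.eigenvectorBasis p) with hU
  have horth : ∀ p q, dotp (U p) (U q) = if p = q then 1 else 0 := by
    intro p q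
    rw [← orthonormal_iff_ite.1 hM.eigenvectorBasis.orthonormal p q]
    simp [dotp, hU, PiLp.inner_apply, mul_comm]
  have hframe : ∀ s t, ∑ p, U p s * U p t = if s = t then 1 else 0 := by
    intro s t
    have hmul : (Matrix.of U) * (Matrix.of U).transpose = 1 := by
      ext p q
      simpa [Matrix.mul_apply, Matrix.one_apply, dotp] using horth p q
    have := congrArg (fun B : Matrix T T ℝ => B s t) (mul_eq_one_comm.1 hmul)
    simpa [Matrix.mul_apply, Matrix.one_apply] using this
  have hquad : ∀ p q, ∑ a, ∑ b, U p a * U q b * M a b =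
      hM.eigenvalues q * if p = q then 1 else 0 := by
    intro p q
    rw [← horth, dotp, Finset.mul_sum]
    refine Finset.sum_congr rfl fun a _ => ?_
    have := congrFun (hM.mulVec_eigenvectorBasis q) a
    simp only [Matrix.mulVec, dotProduct, Pi.smul_apply, smul_eq_mul] at this
    rw [mul_left_comm, ← this, Finset.mul_sum]
    exact Finset.sum_congr rfl fun b _ => by ring
  obtain ⟨S, hS, -, hcard⟩ := Finset.exists_subsuperset_card_eq
    (s := (univ.filter fun p => hM.eigenvalues p ≠ 0).map
      (Function.Embedding.inl : T ↪ T ⊕ Fin ρ))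
    (t := univ) (n := ρ) (subset_univ _)
    (by
      rw [Finset.card_map, ← Fintype.card_subtype, ← hM.rank_eq_card_non_zero_eigs]
      exact hρ)
    (by simp)
  have hrange : Set.range (fun a => ((S.equivFinOfCardEq hcard).symm a : T ⊕ Fin ρ)) = S := by
    rw [Set.range_comp' Subtype.val, Equiv.range_eq_univ]
    simp
  refine ⟨Sum.elim U 0, fun a => ((S.equivFinOfCardEq hcard).symm a : T ⊕ Fin ρ),
    Subtype.val_injective.comp (Equiv.injective _), fun s t => ?_, ?_, ?_, ?_⟩
  · simpa using hframe s t
  · rintro (p | p)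
    · rw [enorm2_eq_dotp, Sum.elim_inl, horth, if_pos rfl]
    · simp [enorm2]
  · rintro (p | p) (q | q) hpq
    · rw [Sum.elim_inl, Sum.elim_inl, horth, if_neg (by simpa using hpq)]
    all_goals simp [dotp]
  · rw [hrange]
    rintro (p | p) (q | q) hpq
    · rw [Sum.elim_inl, Sum.elim_inl, hquad]
      by_cases h : p = q
      · subst h
        have hp : Sum.inl p ∉ S := by simpa using hpq
        have : hM.eigenvalues p = 0 := by
          by_contra hne
          exact hp (hS (by simpa using hne))
        rw [this, zero_mul]
      · rw [if_neg h, mul_zero]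
    all_goals simp

/-- Existence of the higher-order singular value decomposition, with zero factor vectors
allowed. -/
lemma exists_hosvd {ι T : Type*} [Fintype ι] [DecidableEq ι] [Fintype T] [DecidableEq T]
    {ρ : ℕ} (C : (ι → Fin ρ) → ℝ) (w : ι → Fin ρ → T → ℝ) :
    ∃ (D : (ι → Fin ρ) → ℝ) (v : ι → Fin ρ → T → ℝ), tucker D v = tucker C w ∧
      (∀ i p, enorm2 (v i p) ≤ 1) ∧ (∀ i p q, p ≠ q → dotp (v i p) (v i q) = 0) ∧
      (∀ i p q, p ≠ q → modeGram D i p q = 0) ∧ enorm2 D = enorm2 (tucker C w) := by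
  set Z := tucker C w
  have hrank : ∀ i, (modeGram Z i).rank ≤ ρ := fun i => by
    simpa using rank_modeGram_tucker_le C w i
  choose V g hg hframe hnorm horth hquad using fun i =>
    exists_padded_eigenbasis (modeGram_isHermitian Z i) (hrank i)
  set E : (ι → T ⊕ Fin ρ) → ℝ := tucker Z fun i t x => V i x t with hE
  have hgram : ∀ i x y, x ≠ y ∨ x ∉ Set.range (g i) → modeGram E i x y = 0 := fun i x y h => by
    rw [hE, modeGram_tucker_of_frame Z V hframe, hquad i x y h]
  set G : (ι → Fin ρ) → ι → T ⊕ Fin ρ := fun a i => g i (a i) with hG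
  have hGinj : Function.Injective G := fun a b h => funext fun i => hg i (congrFun h i)
  have hzero : ∀ k, k ∉ Set.range G → E k = 0 := by
    intro k hk
    obtain ⟨i, hi⟩ : ∃ i, k i ∉ Set.range (g i) := by
      by_contra! h
      choose a ha using h
      exact hk ⟨a, funext ha⟩
    exact eq_zero_of_modeGram_self (hgram i _ _ (Or.inr hi))
  refine ⟨E ∘ G, fun i a => V i (g i a), ?_, fun i p => hnorm i _,
    fun i p q hpq => horth i _ _ ((hg i).ne hpq), fun i p q hpq => ?_, ?_⟩
  · calc tucker (E ∘ G) (fun i a => V i (g i a)) = tucker E V := by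
          funext t
          exact Fintype.sum_of_injective G hGinj _ _ (fun k hk => by rw [hzero k hk, zero_mul])
            fun a => rfl
      _ = Z := by
          rw [hE, tucker_tucker]
          simp only [hframe]
          exact tucker_one Z
  · rw [← hgram i (g i p) (g i q) (Or.inl ((hg i).ne hpq))]
    refine Fintype.sum_of_injective G hGinj _ _ (fun k hk => by simp [hzero k hk]) fun a => ?_
    have hupd : G (Function.update a i q) = Function.update (G a) i (g i q) := by
      funext j
      by_cases h : j = i
      · subst h
        simp [hG]
      · simp [hG, h]
    have hcond : G a i = g i p ↔ a i = p := (hg i).eq_iff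
    simp only [Function.comp_apply, hupd, hcond]
  · calc enorm2 (E ∘ G) = enorm2 E :=
          Fintype.sum_of_injective G hGinj _ _ (fun k hk => by simp [hzero k hk]) fun a => rfl
      _ = enorm2 Z := enorm2_tucker_of_orthonormal _ _ hframe

lemma smul_tucker {ι J T : Type*} [Fintype ι] [DecidableEq ι] [Fintype J]
    (c : ℝ) (C : (ι → J) → ℝ) (w : ι → J → T → ℝ) : c • tucker C w = tucker (c • C) w := by
  funext t
  simp [tucker, Finset.mul_sum, mul_assoc]

lemma vect_smul {d' m : ℕ} (c : ℝ) (Z : (Fin d' → Fin m) → ℝ) :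
    vect (c • Z) = c • vect Z := rfl

/-- Every tensor of multilinear rank at most `(ρ, …, ρ)` and unit norm lies in the set
`B_{R,μ,θ,(ρ,…,ρ)}` as soon as `R ≥ 1`, `μ ≥ 0` and `θ ≤ 1`. -/
lemma tucker_mem_BSet {d' m ρ : ℕ} {R μ θ : ℝ} (hR : 1 ≤ R) (hμ : 0 ≤ μ) (hθ : θ ≤ 1)
    (C : (Fin d' → Fin ρ) → ℝ) (w : Fin d' → Fin ρ → Fin m → ℝ)
    (hZ : enorm2 (tucker C w) = 1) : tucker C w ∈ BSet d' m ρ R μ θ := by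
  obtain ⟨D, v, hDv, hnorm, horth, hgram, hD⟩ := exists_hosvd C w
  refine ⟨D, v, fun i k => ?_, fun i k k' hk => ?_, hD.trans hZ,
    fun i p q hpq => hgram i p q hpq, ?_, fun t => congrFun hDv.symm t⟩
  · exact (Real.sqrt_le_one.2 (hnorm i k)).trans hR
  · rw [horth i k k' hk, abs_zero]
    exact hμ
  · rwa [hZ, Real.sqrt_one]

lemma rip_tucker_of_rip_BSet {d' m m₂ ρ : ℕ} {R μ θ η : ℝ} (hR : 1 ≤ R) (hμ : 0 ≤ μ)
    (hθ : θ ≤ 1) (A : Matrix (Fin m₂) (Fin (m ^ d')) ℝ)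
    (hA : ∀ Z ∈ BSet d' m ρ R μ θ, (1 - η) * enorm2 Z ≤ enorm2 (A.mulVec (vect Z)) ∧
      enorm2 (A.mulVec (vect Z)) ≤ (1 + η) * enorm2 Z)
    (C : (Fin d' → Fin ρ) → ℝ) (w : Fin d' → Fin ρ → Fin m → ℝ) :
    (1 - η) * enorm2 (tucker C w) ≤ enorm2 (A.mulVec (vect (tucker C w))) ∧
      enorm2 (A.mulVec (vect (tucker C w))) ≤ (1 + η) * enorm2 (tucker C w) := by
  rcases (enorm2_nonneg (tucker C w)).eq_or_lt with h | h
  · have hvect : vect (0 : (Fin d' → Fin m) → ℝ) = 0 := rfl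
    rw [enorm2_eq_zero h.symm, hvect, Matrix.mulVec_zero]
    simp [enorm2]
  · set c := (Real.sqrt (enorm2 (tucker C w)))⁻¹ with hc
    have hcpos : 0 < c ^ 2 := by positivity
    have hcmul : c ^ 2 * enorm2 (tucker C w) = 1 := by
      rw [hc, inv_pow, Real.sq_sqrt h.le, inv_mul_cancel₀ h.ne']
    have hunit : enorm2 (tucker (c • C) w) = 1 := by
      rw [← smul_tucker, enorm2_smul, hcmul]
    have key := hA _ (tucker_mem_BSet hR hμ hθ (c • C) w hunit)
    rw [← smul_tucker, vect_smul, Matrix.mulVec_smul, enorm2_smul, enorm2_smul,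
      mul_left_comm, mul_left_comm (1 + η)] at key
    exact ⟨le_of_mul_le_mul_left key.1 hcpos, le_of_mul_le_mul_left key.2 hcpos⟩

lemma S1_nonempty {n κ : ℕ} (hn : 1 ≤ n) : (S1 n κ).Nonempty := by
  refine ⟨_, fun _ => Pi.single ⟨0, hn⟩ 1, fun _ => ?_, rfl⟩
  simp [enorm2, Pi.single_apply]

lemma MatrixRIP.nonneg {m n κ : ℕ} (hn : 1 ≤ n) {A : Matrix (Fin m) (Fin (n ^ κ)) ℝ} {ε : ℝ}
    (hA : MatrixRIP A ε (S12 n κ)) : 0 ≤ ε := by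
  obtain ⟨x, hx⟩ := S1_nonempty (κ := κ) hn
  have := hA x (Or.inl hx)
  rw [enorm2_of_mem_S1 hx] at this
  linarith [this.1, this.2]

lemma MatrixRIP.abs_dotp_sub_le {m n κ r : ℕ} (hκ : 1 ≤ κ)
    {A : Matrix (Fin m) (Fin (n ^ κ)) ℝ} {ε : ℝ} (hA : MatrixRIP A ε (S12 n κ))
    (u : Fin κ → Fin r → Fin n → ℝ)
    (hu : ∀ a x y, dotp (u a x) (u a y) = if x = y then 1 else 0) (p q : Fin κ → Fin r) :
    |dotp (A.mulVec (kron fun a => u a (p a))) (A.mulVec (kron fun a => u a (q a))) -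
      if p = q then 1 else 0| ≤ ε := by
  have hmem : ∀ p : Fin κ → Fin r, kron (fun a => u a (p a)) ∈ S1 n κ := fun p =>
    ⟨_, fun a => by rw [enorm2_eq_dotp, hu, if_pos rfl], rfl⟩
  split_ifs with h
  · subst h
    have := hA _ (Or.inl (hmem p))
    rw [enorm2_of_mem_S1 (hmem p)] at this
    rw [← enorm2_eq_dotp, abs_le]
    constructor <;> linarith [this.1, this.2]
  · rw [sub_zero]
    refine hA.abs_dotp_le hκ (hmem p) (hmem q) ?_
    rw [dotp_kron]
    obtain ⟨a, ha⟩ := Function.ne_iff.1 h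
    exact Finset.prod_eq_zero (mem_univ a) (by rw [hu, if_neg ha])

lemma one_add_pow_sub_one_le {ε : ℝ} (hε : 0 ≤ ε) {d : ℕ} (hd : d * ε ≤ 1) :
    (1 + ε) ^ d - 1 ≤ 2 * d * ε := by
  have hpow : (1 + ε) ^ d ≤ Real.exp (d * ε) := by
    rw [Real.exp_nat_mul]
    gcongr
    linarith [Real.add_one_le_exp ε]
  have h0 : 0 ≤ d * ε := by positivity
  have := (abs_le.1 (Real.abs_exp_sub_one_sub_id_le (abs_le.2 ⟨by linarith, hd⟩))).2
  nlinarith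

/-- Theorem: two-step modewise TRIP. Let `d = κ·d'`, `r ≥ 2`. Suppose
each `Aᵢ ∈ ℝ^{m×n^κ}` satisfies RIP(ε, S_{1,2}) with `δ := 12·d'·r^d·ε < 1`, and that
`A_2nd ∘ vect` satisfies RIP(δ/3, B_{1+ε,ε,1−δ/3,(r^κ,…,r^κ)}) on `d'`-mode tensors of
side length `m`. Then `𝒜_2nd = A_2nd ∘ vect ∘ 𝒜 ∘ R` satisfies TRIP(δ, (r,…,r)). -/
theorem stmt4 (n m m₂ κ d' r : ℕ) (hn : 1 ≤ n) (hm : 1 ≤ m) (hκ : 1 ≤ κ) (hd' : 1 ≤ d')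
    (hr : 2 ≤ r)
    (A : Fin d' → Matrix (Fin m) (Fin (n ^ κ)) ℝ)
    (A2nd : Matrix (Fin m₂) (Fin (m ^ d')) ℝ) (ε δ : ℝ)
    (hA : ∀ i, MatrixRIP (A i) ε (S12 n κ))
    (hδ : δ = 12 * d' * (r : ℝ) ^ (κ * d') * ε)
    (hδ1 : δ < 1)
    (hA2nd : ∀ Z ∈ BSet d' m (r ^ κ) (1 + ε) ε (1 - δ / 3),
      (1 - δ / 3) * enorm2 Z ≤ enorm2 (A2nd.mulVec (vect Z)) ∧
        enorm2 (A2nd.mulVec (vect Z)) ≤ (1 + δ / 3) * enorm2 Z)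
    (X : (Fin (κ * d') → Fin n) → ℝ)
    (hX : HOSVDRankLE (κ * d') n r X) :
    (1 - δ) * enorm2 X ≤
        enorm2 (A2nd.mulVec (vect (modewiseAll A (reshape n κ d' X)))) ∧
      enorm2 (A2nd.mulVec (vect (modewiseAll A (reshape n κ d' X)))) ≤
        (1 + δ) * enorm2 X := by
  obtain ⟨C, u, hu1, hu0, hXC⟩ := hX
  have hε : 0 ≤ ε := (hA ⟨0, hd'⟩).nonneg hn
  have hδ0 : 0 ≤ δ := hδ ▸ by positivity
  have hu : ∀ i x y, dotp (u i x) (u i y) = if x = y then 1 else 0 := by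
    intro i x y
    split_ifs with h
    · rw [h, ← enorm2_eq_dotp, hu1]
    · exact hu0 i x y h
  obtain rfl : X = tucker C u := funext hXC
  have hXnorm : enorm2 (tucker C u) = enorm2 (reshape r κ d' C) := by
    rw [enorm2_tucker_of_orthonormal C u hu, enorm2_reshape]
  rw [reshape_tucker, modewiseAll_tucker, hXnorm]
  set D := reshape r κ d' C
  set w : Fin d' → Fin (r ^ κ) → Fin m → ℝ := fun i p => (A i).mulVec
    (kron fun a => u (blockIdx κ d' i a) (finFunctionFinEquiv.symm p a))
  have hgram : ∀ i p q, |dotp (w i p) (w i q) - if p = q then 1 else 0| ≤ ε := by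
    intro i p q
    have := (hA i).abs_dotp_sub_le hκ (fun a => u (blockIdx κ d' i a)) (fun a => hu _)
      (finFunctionFinEquiv.symm p) (finFunctionFinEquiv.symm q)
    simpa only [EmbeddingLike.apply_eq_iff_eq] using this
  have hcard : (Fintype.card (Fin d' → Fin (r ^ κ)) : ℝ) = (r : ℝ) ^ (κ * d') := by
    simp [pow_mul]
  have hrpow : (1 : ℝ) ≤ (r : ℝ) ^ (κ * d') :=
    one_le_pow₀ (by exact_mod_cast (by omega : 1 ≤ r))
  have hdε : d' * ε ≤ 1 := by
    have : (d' * ε) * 1 ≤ (d' * ε) * (r : ℝ) ^ (κ * d') := by gcongr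
    linarith
  have hfirst : |enorm2 (tucker D w) - enorm2 D| ≤ δ / 6 * enorm2 D := by
    refine (abs_enorm2_tucker_sub_le D w hε hgram).trans ?_
    refine mul_le_mul_of_nonneg_right ?_ (enorm2_nonneg D)
    rw [hcard, Fintype.card_fin]
    calc ((1 + ε) ^ d' - 1) * (r : ℝ) ^ (κ * d')
        ≤ (2 * d' * ε) * (r : ℝ) ^ (κ * d') := by
          gcongr
          exact one_add_pow_sub_one_le hε hdε
      _ = δ / 6 := by
          rw [hδ]
          ring
  have hsecond := rip_tucker_of_rip_BSet (by linarith) hε (by linarith) A2nd hA2nd D w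
  rw [abs_le] at hfirst
  have hD := enorm2_nonneg D
  constructor
  · nlinarith [hsecond.1, hfirst.1, mul_nonneg hδ0 hD]
  · nlinarith [hsecond.2, hfirst.2, mul_nonneg hδ0 hD]
end

section
/- Let d, n, r ≥ 1 be integers, θ ≥ 0, 0 < ε < 1, 0 < μ < 1, and R ≥ 1. Then the covering number of B_{R,μ,θ,(r,…,r)} at scale ε in the Frobenius norm satisfies N(B_{R,μ,θ,(r,…,r)}, ‖·‖_F, ε) ≤ (6(d+1)/ε)^{r^d + rnd} · (R² + μr)^{r^d d/2} · (R² + μ r^d)^{dnr/2} · R^{(d−1)dnr}. -/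
open Finset

noncomputable section

open scoped RealInnerProductSpace ENNReal

/-- The covering number `N(S, t)`: the minimal cardinality of a subset of `S` whose
`t`-neighborhoods cover `S` (`⊤` if no finite such net exists). -/
def coveringNumber {α : Type*} [PseudoMetricSpace α] (S : Set α) (t : ℝ) : ℕ∞ :=
  ⨅ (N : Finset α) (_ : ↑N ⊆ S) (_ : ∀ x ∈ S, ∃ y ∈ N, dist x y ≤ t), (N.card : ℕ∞)

/-- The set `B_{R,μ,θ,(r,…,r)}` of nearly orthogonal `d`-mode tensors with side length
`n`: tensors representable as `Z(t) = Σ_k C(k) ∏ᵢ uⁱ_{kᵢ}(tᵢ)` where (a) `‖uⁱ_k‖₂ ≤ R`,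
(b) `|⟨uⁱ_k, uⁱ_{k'}⟩| ≤ μ` for `k ≠ k'`, (c) `‖C‖_F = 1`, (d) `C` has orthogonal
subtensors, and (e) `‖Z‖_F ≥ θ`. -/
def BSetE (d n r : ℕ) (R μ θ : ℝ) : Set (EuclideanSpace ℝ (Fin d → Fin n)) :=
  {Z | ∃ (C : (Fin d → Fin r) → ℝ) (u : Fin d → Fin r → EuclideanSpace ℝ (Fin n)),
    (∀ i k, ‖u i k‖ ≤ R) ∧
    (∀ i k k', k ≠ k' → |⟪u i k, u i k'⟫| ≤ μ) ∧
    (∑ k : Fin d → Fin r, (C k) ^ 2) = 1 ∧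
    (∀ (i : Fin d) (p q : Fin r), p ≠ q →
      (∑ k : Fin d → Fin r, if k i = p then C k * C (Function.update k i q) else 0) = 0) ∧
    θ ≤ ‖Z‖ ∧
    (∀ t, Z t = ∑ k : Fin d → Fin r, C k * ∏ i, u i (k i) (t i))}

lemma coveringNumber_le_card {α β : Type*} [PseudoMetricSpace α] {S : Set α} {t : ℝ}
    (T : Finset β) (rel : α → β → Prop) (hT : ∀ x ∈ S, ∃ b ∈ T, rel x b)
    (hrel : ∀ x ∈ S, ∀ y ∈ S, ∀ b, rel x b → rel y b → dist x y ≤ t) :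
    coveringNumber S t ≤ T.card := by
  classical
  let T' := T.filter fun b => ∃ x ∈ S, rel x b
  have hT' : ∀ b : T', ∃ x ∈ S, rel x b := fun b => (Finset.mem_filter.1 b.2).2
  choose g hgS hg using hT'
  have hcard : (T'.attach.image g).card ≤ T.card :=
    Finset.card_image_le.trans (by simpa using Finset.card_filter_le _ _)
  refine (iInf₂_le_of_le (T'.attach.image g) ?_ (iInf_le _ ?_)).trans (by exact_mod_cast hcard)
  · intro x hx
    obtain ⟨b, -, rfl⟩ := Finset.mem_image.1 (Finset.mem_coe.1 hx)
    exact hgS b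
  · intro x hx
    obtain ⟨b, hb, hxb⟩ := hT x hx
    have hb' : b ∈ T' := Finset.mem_filter.2 ⟨hb, x, hx, hxb⟩
    exact ⟨g ⟨b, hb'⟩, Finset.mem_image_of_mem _ (Finset.mem_attach _ _),
      hrel x hx _ (hgS _) b hxb (hg _)⟩

lemma card_le_of_pairwise_le_dist {E : Type*} [NormedAddCommGroup E] [NormedSpace ℝ E]
    [FiniteDimensional ℝ E] {ρ η : ℝ} (hρ : 0 ≤ ρ) (hη : 0 < η) (s : Finset E)
    (hs : ∀ c ∈ s, ‖c‖ ≤ ρ) (h : ∀ c ∈ s, ∀ c' ∈ s, c ≠ c' → η ≤ dist c c') :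
    (s.card : ℝ) ≤ (1 + 2 * ρ / η) ^ Module.finrank ℝ E := by
  borelize E
  let μ : MeasureTheory.Measure E := MeasureTheory.Measure.addHaar
  have hη2 : 0 < η / 2 := by positivity
  have hρη : 0 < ρ + η / 2 := by positivity
  have D : Set.Pairwise (s : Set E) (Function.onFun Disjoint fun c => Metric.ball c (η / 2)) := by
    intro c hc c' hc' hcc'
    apply Metric.ball_disjoint_ball
    linarith [h c hc c' hc' hcc']
  have A_subset : (⋃ c ∈ s, Metric.ball c (η / 2)) ⊆ Metric.ball (0 : E) (ρ + η / 2) := by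
    refine Set.iUnion₂_subset fun x hx => Metric.ball_subset_ball' ?_
    rw [dist_zero_right]
    linarith [hs x hx]
  have I := MeasureTheory.measure_mono (μ := μ) A_subset
  rw [MeasureTheory.measure_biUnion_finset D fun c _ => measurableSet_ball] at I
  simp only [μ.addHaar_ball_of_pos _ hη2, μ.addHaar_ball_of_pos _ hρη, Finset.sum_const,
    nsmul_eq_mul, ← mul_assoc] at I
  have J := (ENNReal.mul_le_mul_iff_left (Metric.measure_ball_pos μ (0 : E) zero_lt_one).ne'
    MeasureTheory.measure_ball_lt_top.ne).1 I
  have K := ENNReal.toReal_le_of_le_ofReal (by positivity) J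
  rw [ENNReal.toReal_mul, ENNReal.toReal_natCast, ENNReal.toReal_ofReal (by positivity)] at K
  have e : 1 + 2 * ρ / η = (ρ + η / 2) / (η / 2) := by field_simp; ring
  rw [e, div_pow, le_div_iff₀ (by positivity)]
  exact K

lemma exists_finset_cover_closedBall (E : Type*) [NormedAddCommGroup E] [NormedSpace ℝ E]
    [FiniteDimensional ℝ E] {ρ δ : ℝ} (hδ : 0 < δ) (hδρ : δ ≤ 2 * ρ) :
    ∃ s : Finset E, (s.card : ℝ) ≤ (6 * ρ / δ) ^ Module.finrank ℝ E ∧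
      ∀ x : E, ‖x‖ ≤ ρ → ∃ c ∈ s, ‖x - c‖ ≤ δ / 2 := by
  classical
  let P : Finset E → Prop := fun s =>
    (∀ c ∈ s, ‖c‖ ≤ ρ) ∧ ∀ c ∈ s, ∀ c' ∈ s, c ≠ c' → δ / 2 ≤ dist c c'
  have hP : ∀ s, P s → (s.card : ℝ) ≤ (1 + 2 * ρ / (δ / 2)) ^ Module.finrank ℝ E := fun s hs =>
    card_le_of_pairwise_le_dist (by linarith) (by positivity) s hs.1 hs.2
  let K : Set ℕ := {k | ∃ s, P s ∧ s.card = k}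
  have hKne : K.Nonempty := ⟨0, ∅, by simp [P], rfl⟩
  have hKb : BddAbove K := by
    refine ⟨⌈(1 + 2 * ρ / (δ / 2)) ^ Module.finrank ℝ E⌉₊, ?_⟩
    rintro k ⟨s, hs, rfl⟩
    exact_mod_cast (hP s hs).trans (Nat.le_ceil _)
  obtain ⟨s, hs, hcard⟩ := Nat.sSup_mem hKne hKb
  have hmax : ∀ t, P t → t.card ≤ s.card := fun t ht => hcard ▸ le_csSup hKb ⟨t, ht, rfl⟩
  refine ⟨s, (hP s hs).trans ?_, fun x hx => ?_⟩
  · have : 0 ≤ ρ := by linarith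
    refine pow_le_pow_left₀ (by positivity) ?_ _
    rw [div_div_eq_mul_div, ← sub_nonneg]
    have : 6 * ρ / δ - (1 + 2 * ρ * 2 / δ) = (2 * ρ - δ) / δ := by field_simp; ring
    rw [this]
    exact div_nonneg (by linarith) hδ.le
  · by_contra! hfar
    have hxs : x ∉ s := fun h => by
      have := hfar x h
      rw [sub_self, norm_zero] at this
      linarith
    have := hmax (insert x s) ⟨?_, ?_⟩
    · rw [Finset.card_insert_of_notMem hxs] at this
      omega
    · intro c hc
      rcases Finset.mem_insert.1 hc with rfl | hc
      exacts [hx, hs.1 c hc]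
    · intro c hc c' hc' hne
      rcases Finset.mem_insert.1 hc with h | hc <;> rcases Finset.mem_insert.1 hc' with h' | hc'
      · exact absurd (h.trans h'.symm) hne
      · rw [h, dist_eq_norm]
        exact (hfar c' hc').le
      · rw [h', dist_comm, dist_eq_norm]
        exact (hfar c hc).le
      · exact hs.2 c hc c' hc' hne

/-- The tensor with core `C` and mode-`i` factors `u i`. -/
def tuckerTensor {ι κ ν : Type*} [Fintype ι] [DecidableEq ι] [Fintype κ] (C : (ι → κ) → ℝ)
    (u : ι → κ → EuclideanSpace ℝ ν) : EuclideanSpace ℝ (ι → ν) :=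
  WithLp.toLp 2 fun t => ∑ k, C k * ∏ i, u i (k i) (t i)

section Tucker

variable {ι κ ν : Type*} [Fintype ι] [DecidableEq ι] [Fintype κ]

lemma norm_sq_tuckerTensor [Fintype ν] (C : (ι → κ) → ℝ) (u : ι → κ → EuclideanSpace ℝ ν) :
    ‖tuckerTensor C u‖ ^ 2 = ∑ k, ∑ l, C k * C l * ∏ i, ⟪u i (k i), u i (l i)⟫ := by
  have hinner : ∀ k l : ι → κ, ∏ i, ⟪u i (k i), u i (l i)⟫ =
      ∑ t : ι → ν, (∏ i, u i (k i) (t i)) * ∏ i, u i (l i) (t i) := by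
    intro k l
    simp only [PiLp.inner_apply, RCLike.inner_apply, conj_trivial, Fintype.prod_sum,
      ← Finset.prod_mul_distrib]
    exact Finset.sum_congr rfl fun t _ => Finset.prod_congr rfl fun i _ => mul_comm _ _
  rw [EuclideanSpace.real_norm_sq_eq]
  simp only [tuckerTensor, hinner, sq, Finset.sum_mul_sum]
  rw [Finset.sum_comm]
  refine Finset.sum_congr rfl fun k _ => ?_
  rw [Finset.sum_comm]
  simp only [Finset.mul_sum]
  exact Finset.sum_congr rfl fun l _ => Finset.sum_congr rfl fun t _ => by ring

lemma tuckerTensor_sub_core (C C' : (ι → κ) → ℝ) (u : ι → κ → EuclideanSpace ℝ ν) :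
    tuckerTensor C u - tuckerTensor C' u = tuckerTensor (C - C') u := by
  ext t
  simp [tuckerTensor, sub_mul]

lemma tuckerTensor_update_sub (C : (ι → κ) → ℝ) (u : ι → κ → EuclideanSpace ℝ ν) (j : ι)
    (a b : κ → EuclideanSpace ℝ ν) :
    tuckerTensor C (Function.update u j a) - tuckerTensor C (Function.update u j b) =
      tuckerTensor C (Function.update u j (a - b)) := by
  ext t
  simp only [tuckerTensor, PiLp.sub_apply, ← Finset.sum_sub_distrib]
  refine Finset.sum_congr rfl fun k _ => ?_
  simp only [Fintype.prod_eq_mul_prod_subtype_ne _ j, Function.update_self]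
  have (i : {i // i ≠ j}) (c : κ → EuclideanSpace ℝ ν) : Function.update u j c i = u i :=
    Function.update_of_ne i.2 _ _
  simp only [this, Pi.sub_apply, PiLp.sub_apply]
  ring

lemma norm_sq_tuckerTensor_le [Fintype ν] {u : ι → κ → EuclideanSpace ℝ ν} {R μ : ℝ} (hμ : 0 ≤ μ)
    (hu : ∀ i k, ‖u i k‖ ≤ R) (hinner : ∀ i k k', k ≠ k' → |⟪u i k, u i k'⟫| ≤ μ)
    (C : (ι → κ) → ℝ) :
    ‖tuckerTensor C u‖ ^ 2 ≤ (R ^ 2 + μ * Fintype.card κ) ^ Fintype.card ι * ∑ k, C k ^ 2 := by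
  classical
  let K : (ι → κ) → (ι → κ) → ℝ := fun k l => ∏ i, |⟪u i (k i), u i (l i)⟫|
  have hKcomm : ∀ k l, K k l = K l k := fun k l => by simp only [K, real_inner_comm]
  have hrow : ∀ k, ∑ l, K k l ≤ (R ^ 2 + μ * Fintype.card κ) ^ Fintype.card ι := by
    intro k
    rw [← Fintype.prod_sum fun i m => |⟪u i (k i), u i m⟫|]
    rw [← Finset.card_univ (α := ι), ← Finset.prod_const]
    refine Finset.prod_le_prod (fun i _ => Finset.sum_nonneg fun m _ => abs_nonneg _) fun i _ => ?_
    calc ∑ m, |⟪u i (k i), u i m⟫| ≤ ∑ m, ((if m = k i then R ^ 2 else 0) + μ) := by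
          refine Finset.sum_le_sum fun m _ => ?_
          split_ifs with h
          · subst h
            rw [real_inner_self_eq_norm_sq, abs_of_nonneg (by positivity)]
            have := pow_le_pow_left₀ (norm_nonneg _) (hu i (k i)) 2
            linarith
          · simpa using hinner i _ _ (Ne.symm h)
      _ = R ^ 2 + μ * Fintype.card κ := by
          simp [Finset.sum_add_distrib, mul_comm]
  have hK0 : ∀ k l, 0 ≤ K k l := fun k l => Finset.prod_nonneg fun i _ => abs_nonneg _
  calc ‖tuckerTensor C u‖ ^ 2
      ≤ ∑ k, ∑ l, (C k ^ 2 * K k l / 2 + C l ^ 2 * K k l / 2) := by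
        rw [norm_sq_tuckerTensor]
        refine Finset.sum_le_sum fun k _ => Finset.sum_le_sum fun l _ => ?_
        refine (le_abs_self _).trans ?_
        rw [abs_mul, abs_mul, Finset.abs_prod]
        have h1 : |C k| * |C l| ≤ C k ^ 2 / 2 + C l ^ 2 / 2 := by
          nlinarith [sq_nonneg (|C k| - |C l|), sq_abs (C k), sq_abs (C l)]
        calc _ ≤ (C k ^ 2 / 2 + C l ^ 2 / 2) * K k l := mul_le_mul_of_nonneg_right h1 (hK0 k l)
          _ = _ := by ring
    _ = ∑ k, C k ^ 2 * ∑ l, K k l := by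
        have h2 : ∑ k, ∑ l, C l ^ 2 * K k l / 2 = ∑ k, ∑ l, C k ^ 2 * K k l / 2 := by
          rw [Finset.sum_comm]
          exact Finset.sum_congr rfl fun k _ => Finset.sum_congr rfl fun l _ => by rw [hKcomm]
        simp only [Finset.sum_add_distrib, h2]
        rw [← Finset.sum_add_distrib]
        refine Finset.sum_congr rfl fun k _ => ?_
        rw [← Finset.sum_add_distrib, Finset.mul_sum]
        exact Finset.sum_congr rfl fun l _ => by ring
    _ ≤ ∑ k, C k ^ 2 * (R ^ 2 + μ * Fintype.card κ) ^ Fintype.card ι :=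
        Finset.sum_le_sum fun k _ => mul_le_mul_of_nonneg_left (hrow k) (sq_nonneg _)
    _ = _ := by rw [← Finset.sum_mul, mul_comm]

lemma sum_sum_inner_mul_le {P M V : Type*} [Fintype P] [Fintype M] [NormedAddCommGroup V]
    [InnerProductSpace ℝ V] {D : P × M → ℝ} {w : P → V} {K : M → M → ℝ} {δ B B' : ℝ}
    (hB' : 0 ≤ B') (hw : ∀ p, ‖w p‖ ≤ δ) (hB : ∀ m, K m m ≤ B) (hB0 : 0 ≤ B)
    (hoff : ∀ m m', m ≠ m' → |K m m'| ≤ B')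
    (horth : ∀ p q, p ≠ q → ∑ m, D (p, m) * D (q, m) = 0) (hD : ∑ x, D x ^ 2 = 1) :
    ∑ x : P × M, ∑ y : P × M, D x * D y * (⟪w x.1, w y.1⟫ * K x.2 y.2) ≤
      δ ^ 2 * (B + B' * (Fintype.card P * Fintype.card M : ℕ)) := by
  classical
  have hdiag : ∑ m, ⟪∑ p, D (p, m) • w p, ∑ p, D (p, m) • w p⟫ ≤ δ ^ 2 := by
    calc ∑ m, ⟪∑ p, D (p, m) • w p, ∑ p, D (p, m) • w p⟫
        = ∑ p, ∑ q, ⟪w p, w q⟫ * ∑ m, D (p, m) * D (q, m) := by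
          simp only [sum_inner, inner_sum, real_inner_smul_left, real_inner_smul_right,
            Finset.mul_sum]
          rw [Finset.sum_comm]
          refine Finset.sum_congr rfl fun p _ => ?_
          rw [Finset.sum_comm]
          refine Finset.sum_congr rfl fun q _ => Finset.sum_congr rfl fun m _ => ?_
          rw [real_inner_comm]
          ring
      _ = ∑ p, ‖w p‖ ^ 2 * ∑ m, D (p, m) ^ 2 := by
          refine Finset.sum_congr rfl fun p _ => ?_
          rw [Finset.sum_eq_single p (fun q _ hq => by rw [horth p q hq.symm, mul_zero])
            (by simp), real_inner_self_eq_norm_sq]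
          simp only [sq]
      _ ≤ ∑ p, δ ^ 2 * ∑ m, D (p, m) ^ 2 := by
          gcongr with p
          exact hw p
      _ = δ ^ 2 := by rw [← Finset.mul_sum, ← Fintype.sum_prod_type (fun x => D x ^ 2), hD, mul_one]
  have hl1 : (∑ x, |D x|) ^ 2 ≤ (Fintype.card P * Fintype.card M : ℕ) := by
    have := sq_sum_le_card_mul_sum_sq (s := Finset.univ) (f := fun x : P × M => |D x|)
    simpa [hD] using this
  calc ∑ x : P × M, ∑ y : P × M, D x * D y * (⟪w x.1, w y.1⟫ * K x.2 y.2)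
      ≤ ∑ x : P × M, ∑ y : P × M, ((if x.2 = y.2 then
          K x.2 x.2 * (D x * D y * ⟪w x.1, w y.1⟫) else 0) + |D x| * |D y| * (δ ^ 2 * B')) := by
        refine Finset.sum_le_sum fun x _ => Finset.sum_le_sum fun y _ => ?_
        have hδ : 0 ≤ δ := (norm_nonneg _).trans (hw x.1)
        split_ifs with h
        · rw [← h]
          have : 0 ≤ |D x| * |D y| * (δ ^ 2 * B') := by positivity
          linarith
        · rw [zero_add]
          refine (le_abs_self _).trans ?_
          rw [abs_mul, abs_mul, abs_mul]
          have h1 : |⟪w x.1, w y.1⟫| ≤ δ ^ 2 := by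
            refine (abs_real_inner_le_norm _ _).trans ?_
            rw [sq]
            exact mul_le_mul (hw _) (hw _) (norm_nonneg _) hδ
          have h2 := hoff _ _ h
          gcongr
    _ = ∑ m, K m m * ⟪∑ p, D (p, m) • w p, ∑ p, D (p, m) • w p⟫ +
          δ ^ 2 * B' * (∑ x, |D x|) ^ 2 := by
        simp only [Finset.sum_add_distrib]
        congr 1
        · simp only [Fintype.sum_prod_type, sum_inner, inner_sum, real_inner_smul_left,
            real_inner_smul_right, Finset.mul_sum, Finset.sum_ite_eq, Finset.mem_univ, if_true]
          rw [Finset.sum_comm]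
          refine Finset.sum_congr rfl fun m _ => ?_
          refine Finset.sum_congr rfl fun p _ => Finset.sum_congr rfl fun q _ => ?_
          rw [real_inner_comm]
          ring
        · rw [sq (∑ x, |D x|), Finset.sum_mul_sum, Finset.mul_sum]
          simp only [Finset.mul_sum]
          exact Finset.sum_congr rfl fun x _ => Finset.sum_congr rfl fun y _ => by ring
    _ ≤ B * δ ^ 2 + δ ^ 2 * B' * (Fintype.card P * Fintype.card M : ℕ) := by
        refine add_le_add ?_ (mul_le_mul_of_nonneg_left hl1 (by positivity))
        calc _ ≤ ∑ m, B * ⟪∑ p, D (p, m) • w p, ∑ p, D (p, m) • w p⟫ :=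
              Finset.sum_le_sum fun m _ =>
                mul_le_mul_of_nonneg_right (hB m) real_inner_self_nonneg
          _ ≤ B * δ ^ 2 := by
              rw [← Finset.mul_sum]
              exact mul_le_mul_of_nonneg_left hdiag hB0
    _ = _ := by ring

lemma norm_sq_tuckerTensor_update_le [Fintype ν] [DecidableEq κ] {u : ι → κ → EuclideanSpace ℝ ν}
    {R μ δ : ℝ} (hR : 0 < R) (hμ : 0 ≤ μ)
    (hu : ∀ i k, ‖u i k‖ ≤ R) (hinner : ∀ i k k', k ≠ k' → |⟪u i k, u i k'⟫| ≤ μ)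
    {C : (ι → κ) → ℝ} (hC : ∑ k, C k ^ 2 = 1) (j : ι)
    (horth : ∀ p q : κ, p ≠ q →
      (∑ k : ι → κ, if k j = p then C k * C (Function.update k j q) else 0) = 0)
    {w : κ → EuclideanSpace ℝ ν} (hw : ∀ p, ‖w p‖ ≤ δ) :
    ‖tuckerTensor C (Function.update u j w)‖ ^ 2 ≤
      δ ^ 2 * ((R ^ 2) ^ (Fintype.card ι - 1) *
        (1 + μ / R ^ 2 * (Fintype.card κ : ℝ) ^ Fintype.card ι)) := by
  let e := Equiv.funSplitAt j κ
  let K : ({i // i ≠ j} → κ) → ({i // i ≠ j} → κ) → ℝ := fun m m' =>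
    ∏ i : {i // i ≠ j}, ⟪u i (m i), u i (m' i)⟫
  have hself : ∀ i k, |⟪u i k, u i k⟫| ≤ R ^ 2 := fun i k => by
    rw [real_inner_self_eq_norm_sq, abs_of_nonneg (by positivity)]
    exact pow_le_pow_left₀ (norm_nonneg _) (hu i k) 2
  have hall : ∀ i k k', |⟪u i k, u i k'⟫| ≤ R ^ 2 := fun i k k' => by
    refine (abs_real_inner_le_norm _ _).trans ?_
    rw [sq]
    exact mul_le_mul (hu _ _) (hu _ _) (norm_nonneg _) hR.le
  have hcard : Fintype.card {i // i ≠ j} = Fintype.card ι - 1 := by simp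
  have hcardP : Fintype.card κ * Fintype.card ({i // i ≠ j} → κ) =
      Fintype.card κ ^ Fintype.card ι := by
    rw [← Fintype.card_prod, ← Fintype.card_congr e, Fintype.card_fun]
  have key := sum_sum_inner_mul_le (D := fun x => C (e.symm x)) (w := w) (K := K) (δ := δ)
    (B := (R ^ 2) ^ (Fintype.card ι - 1)) (B' := (R ^ 2) ^ (Fintype.card ι - 1) * (μ / R ^ 2))
    (by positivity) hw ?_ (by positivity) ?_ ?_ ?_
  · rw [hcardP] at key
    rw [norm_sq_tuckerTensor]
    refine (le_of_eq ?_).trans (key.trans_eq (by push_cast; ring))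
    rw [← e.symm.sum_comp]
    refine Finset.sum_congr rfl fun x _ => ?_
    rw [← e.symm.sum_comp]
    refine Finset.sum_congr rfl fun y _ => ?_
    congr 1
    rw [Fintype.prod_eq_mul_prod_subtype_ne _ j]
    congr 1
    · simp [e]
    · refine Finset.prod_congr rfl fun i _ => ?_
      rw [Function.update_of_ne i.2]
      simp [e, i.2]
  · intro m
    rw [← hcard]
    refine (le_abs_self _).trans ?_
    rw [Finset.abs_prod, ← Finset.card_univ, ← Finset.prod_const]
    exact Finset.prod_le_prod (fun i _ => abs_nonneg _) fun i _ => hself _ _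
  · intro m m' hm
    obtain ⟨i₀, hi₀⟩ := Function.ne_iff.1 hm
    rw [Finset.abs_prod, ← hcard]
    calc ∏ i : {i // i ≠ j}, |⟪u i (m i), u i (m' i)⟫|
        ≤ ∏ i : {i // i ≠ j}, (R ^ 2 * if i = i₀ then μ / R ^ 2 else 1) := by
          refine Finset.prod_le_prod (fun _ _ => abs_nonneg _) fun i _ => ?_
          split_ifs with h
          · subst h
            rw [mul_div_cancel₀ _ (by positivity)]
            exact hinner _ _ _ hi₀
          · rw [mul_one]
            exact hall _ _ _
      _ = _ := by rw [Finset.prod_mul_distrib, Finset.prod_const, Finset.card_univ,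
          Finset.prod_ite_eq' Finset.univ i₀, if_pos (Finset.mem_univ _)]
  · intro p q hpq
    rw [← horth p q hpq, ← e.symm.sum_comp, Fintype.sum_prod_type]
    rw [Finset.sum_eq_single p]
    · refine Finset.sum_congr rfl fun m _ => ?_
      have h1 : e.symm (p, m) j = p := by simp [e]
      have h2 : Function.update (e.symm (p, m)) j q = e.symm (q, m) := by
        ext i
        by_cases hi : i = j
        · subst hi; simp [e]
        · simp [e, hi]
      rw [if_pos h1, h2]
    · intro p' _ hp'
      refine Finset.sum_eq_zero fun m _ => if_neg ?_
      simpa [e] using hp'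
    · simp
  · rw [← hC, ← e.symm.sum_comp]

lemma norm_tuckerTensor_sub_le [Fintype ν] [DecidableEq κ] {u u' : ι → κ → EuclideanSpace ℝ ν}
    {R μ δ : ℝ} (hR : 0 < R) (hμ : 0 ≤ μ) (hδ : 0 ≤ δ)
    (hu : ∀ i k, ‖u i k‖ ≤ R) (hinner : ∀ i k k', k ≠ k' → |⟪u i k, u i k'⟫| ≤ μ)
    (hu' : ∀ i k, ‖u' i k‖ ≤ R) (hinner' : ∀ i k k', k ≠ k' → |⟪u' i k, u' i k'⟫| ≤ μ)
    {C : (ι → κ) → ℝ} (hC : ∑ k, C k ^ 2 = 1)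
    (horth : ∀ (i : ι) (p q : κ), p ≠ q →
      (∑ k : ι → κ, if k i = p then C k * C (Function.update k i q) else 0) = 0)
    (hclose : ∀ i k, ‖u i k - u' i k‖ ≤ δ) :
    ‖tuckerTensor C u - tuckerTensor C u'‖ ≤
      Fintype.card ι * (δ * √((R ^ 2) ^ (Fintype.card ι - 1) *
        (1 + μ / R ^ 2 * (Fintype.card κ : ℝ) ^ Fintype.card ι))) := by
  set L := √((R ^ 2) ^ (Fintype.card ι - 1) *
    (1 + μ / R ^ 2 * (Fintype.card κ : ℝ) ^ Fintype.card ι)) with hL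
  have main : ∀ s : Finset ι,
      ‖tuckerTensor C u - tuckerTensor C (s.piecewise u' u)‖ ≤ s.card * (δ * L) := by
    intro s
    induction s using Finset.induction_on with
    | empty => simp
    | insert j s hj ih =>
      set v := s.piecewise u' u with hv
      have hvj : v = Function.update v j (u j) := by
        conv_lhs => rw [← Function.update_eq_self j v]
        rw [hv, Finset.piecewise_eq_of_notMem _ _ _ hj]
      have hvR : ∀ i k, ‖v i k‖ ≤ R := fun i k => by
        by_cases hi : i ∈ s <;> simp [hv, hi, hu, hu']
      have hvinner : ∀ i k k', k ≠ k' → |⟪v i k, v i k'⟫| ≤ μ := fun i k k' hk => by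
        by_cases hi : i ∈ s <;> simp [hv, hi, hinner i k k' hk, hinner' i k k' hk]
      have step : ‖tuckerTensor C v - tuckerTensor C (Function.update v j (u' j))‖ ≤ δ * L := by
        nth_rewrite 1 [hvj]
        rw [tuckerTensor_update_sub]
        refine (Real.le_sqrt_of_sq_le (norm_sq_tuckerTensor_update_le hR hμ hvR hvinner hC j
          (horth j) (w := u j - u' j) (hclose j))).trans_eq ?_
        rw [Real.sqrt_mul (by positivity), Real.sqrt_sq hδ]
      rw [Finset.piecewise_insert, Finset.card_insert_of_notMem hj]
      refine (norm_sub_le_norm_sub_add_norm_sub _ (tuckerTensor C v) _).trans ?_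
      push_cast
      linarith
  simpa using main Finset.univ

end Tucker

/-- covering numbers of the sets of nearly orthogonal tensors.
For `θ ≥ 0`, `0 < ε, μ < 1`, `R ≥ 1`,
`N(B_{R,μ,θ,(r,…,r)}, ‖·‖_F, ε) ≤ (6(d+1)/ε)^{r^d + rnd} (R²+μr)^{r^d d/2}
(R²+μr^d)^{dnr/2} R^{(d−1)dnr}`. -/
theorem stmt10 (d n r : ℕ) (hd : 1 ≤ d) (hn : 1 ≤ n) (hr : 1 ≤ r) (R μ θ ε : ℝ)
    (hθ : 0 ≤ θ) (hε0 : 0 < ε) (hε1 : ε < 1) (hμ0 : 0 < μ) (hμ1 : μ < 1) (hR : 1 ≤ R) :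
    (coveringNumber (BSetE d n r R μ θ) ε : ℝ≥0∞) ≤
      ENNReal.ofReal ((6 * (d + 1) / ε) ^ (r ^ d + r * n * d) *
        (R ^ 2 + μ * r) ^ (((r ^ d * d : ℕ) : ℝ) / 2) *
        (R ^ 2 + μ * (r : ℝ) ^ d) ^ (((d * n * r : ℕ) : ℝ) / 2) *
        R ^ ((d - 1) * d * n * r)) := by
  have hd0 : 0 < (d : ℝ) + 1 := by positivity
  have hR0 : 0 < R := by linarith
  have hμ := hμ0.le
  have hr1 : (1 : ℝ) ≤ r := by exact_mod_cast hr
  have hR2 : 1 ≤ R ^ 2 := one_le_pow₀ hR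
  set q₁ : ℝ := R ^ 2 + μ * r with hq₁
  set q₂ : ℝ := R ^ 2 + μ * (r : ℝ) ^ d with hq₂
  have hq₁1 : 1 ≤ q₁ := by
    have : 0 ≤ μ * r := by positivity
    linarith
  have hq₂R : R ^ 2 ≤ q₂ := by
    have : 0 ≤ μ * (r : ℝ) ^ d := by positivity
    linarith
  have hL₁ : 1 ≤ √q₁ ^ d := one_le_pow₀ (Real.one_le_sqrt.2 hq₁1)
  have hRq₂ : R ≤ √q₂ := Real.le_sqrt_of_sq_le hq₂R
  set L₂ : ℝ := R ^ (d - 1) * √q₂ / R with hL₂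
  have hL₂1 : 1 ≤ L₂ := by
    rw [hL₂, one_le_div hR0]
    have h1 : 1 ≤ R ^ (d - 1) := one_le_pow₀ hR
    nlinarith
  have hL₂sqrt : √((R ^ 2) ^ (d - 1) * (1 + μ / R ^ 2 * (r : ℝ) ^ d)) = L₂ := by
    have : (R ^ 2) ^ (d - 1) * (1 + μ / R ^ 2 * (r : ℝ) ^ d) = (R ^ (d - 1) / R) ^ 2 * q₂ := by
      rw [hq₂, ← pow_mul, mul_comm 2, pow_mul, div_pow]
      field_simp
    rw [this, Real.sqrt_mul (by positivity), Real.sqrt_sq (by positivity), hL₂]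
    ring
  have hεd : ε / (d + 1) ≤ 1 := by
    rw [div_le_one hd0]
    have : (0 : ℝ) ≤ d := by positivity
    linarith
  have hεd0 : 0 < ε / (d + 1) := by positivity
  set δ₁ : ℝ := ε / (d + 1) / √q₁ ^ d with hδ₁
  set δ₂ : ℝ := ε / (d + 1) / L₂ with hδ₂
  have hδ₁0 : 0 < δ₁ := by positivity
  have hδ₂0 : 0 < δ₂ := by positivity
  have hδ₁1 : δ₁ ≤ 2 * 1 := (div_le_self hεd0.le hL₁).trans (by linarith)
  have hδ₂R : δ₂ ≤ 2 * R := (div_le_self hεd0.le hL₂1).trans (by linarith)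
  obtain ⟨s₁, hs₁card, hs₁⟩ :=
    exists_finset_cover_closedBall (EuclideanSpace ℝ (Fin d → Fin r)) hδ₁0 hδ₁1
  obtain ⟨s₂, hs₂card, hs₂⟩ :=
    exists_finset_cover_closedBall (EuclideanSpace ℝ (Fin n)) hδ₂0 hδ₂R
  let T := s₁ ×ˢ Fintype.piFinset fun _ : Fin d => Fintype.piFinset fun _ : Fin r => s₂
  have hcov : coveringNumber (BSetE d n r R μ θ) ε ≤ T.card := by
    refine coveringNumber_le_card T (fun Z b =>
      ∃ (C : (Fin d → Fin r) → ℝ) (u : Fin d → Fin r → EuclideanSpace ℝ (Fin n)),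
        (∀ i k, ‖u i k‖ ≤ R) ∧ (∀ i k k', k ≠ k' → |⟪u i k, u i k'⟫| ≤ μ) ∧
        (∑ k, C k ^ 2) = 1 ∧
        (∀ (i : Fin d) (p q : Fin r), p ≠ q →
          (∑ k : Fin d → Fin r, if k i = p then C k * C (Function.update k i q) else 0) = 0) ∧
        Z = tuckerTensor C u ∧ ‖WithLp.toLp 2 C - b.1‖ ≤ δ₁ / 2 ∧
        ∀ i k, ‖u i k - b.2 i k‖ ≤ δ₂ / 2) ?_ ?_
    · rintro Z ⟨C, u, hu, hinner, hC, horth, -, hZ⟩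
      obtain ⟨c, hc, hCc⟩ := hs₁ (WithLp.toLp 2 C) (by
        rw [EuclideanSpace.norm_eq]
        simp [hC])
      choose a ha hua using fun i k => hs₂ (u i k) (hu i k)
      refine ⟨(c, a), ?_, C, u, hu, hinner, hC, horth, ?_, hCc, hua⟩
      · simpa [T, Fintype.mem_piFinset, hc] using ha
      · ext t
        exact hZ t
    · rintro Z - Z' - b ⟨C, u, hu, hinner, hC, horth, rfl, hCb, hub⟩
        ⟨C', u', hu', hinner', hC', horth', rfl, hCb', hub'⟩
      have h1 : ‖tuckerTensor C u - tuckerTensor C' u‖ ≤ ε / (d + 1) := by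
        have hCC' : ‖WithLp.toLp 2 (C - C')‖ ≤ δ₁ := by
          have := norm_sub_le_norm_sub_add_norm_sub (WithLp.toLp 2 C) b.1 (WithLp.toLp 2 C')
          rw [norm_sub_rev b.1] at this
          rw [WithLp.toLp_sub]
          linarith
        have hsq := norm_sq_tuckerTensor_le hμ hu hinner (C - C')
        have hnorm : ∑ k, (C - C') k ^ 2 = ‖WithLp.toLp 2 (C - C')‖ ^ 2 := by
          rw [EuclideanSpace.real_norm_sq_eq]
        rw [Fintype.card_fin, Fintype.card_fin, ← hq₁, hnorm] at hsq
        rw [tuckerTensor_sub_core]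
        refine (Real.le_sqrt_of_sq_le hsq).trans ?_
        rw [Real.sqrt_mul (by positivity), Real.sqrt_sq (norm_nonneg _)]
        have hsqrt : √(q₁ ^ d) = √q₁ ^ d := by
          rw [Real.sqrt_eq_iff_mul_self_eq (by positivity) (by positivity), ← mul_pow,
            Real.mul_self_sqrt (by positivity)]
        rw [hsqrt]
        calc _ ≤ √q₁ ^ d * δ₁ := by gcongr
          _ = ε / (d + 1) := by rw [hδ₁]; field_simp
      have h2 : ‖tuckerTensor C' u - tuckerTensor C' u'‖ ≤ d * (ε / (d + 1)) := by
        have := norm_tuckerTensor_sub_le hR0 hμ hδ₂0.le hu hinner hu' hinner' hC' horth'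
          (fun i k => by
            have := norm_sub_le_norm_sub_add_norm_sub (u i k) (b.2 i k) (u' i k)
            rw [norm_sub_rev (b.2 i k)] at this
            linarith [hub i k, hub' i k])
        rw [Fintype.card_fin, Fintype.card_fin, hL₂sqrt] at this
        refine this.trans_eq ?_
        rw [hδ₂]
        field_simp
      rw [dist_eq_norm]
      refine (norm_sub_le_norm_sub_add_norm_sub _ (tuckerTensor C' u) _).trans
        ((add_le_add h1 h2).trans_eq ?_)
      field_simp
      ring
  have hTcard : (T.card : ℝ) = s₁.card * ((s₂.card : ℝ) ^ r) ^ d := by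
    simp [T, Fintype.card_piFinset]
  have hbound : (T.card : ℝ) ≤ (6 * (d + 1) / ε) ^ (r ^ d + r * n * d) *
        q₁ ^ (((r ^ d * d : ℕ) : ℝ) / 2) * q₂ ^ (((d * n * r : ℕ) : ℝ) / 2) *
        R ^ ((d - 1) * d * n * r) := by
    rw [finrank_euclideanSpace, Fintype.card_fun, Fintype.card_fin, Fintype.card_fin] at hs₁card
    rw [finrank_euclideanSpace, Fintype.card_fin] at hs₂card
    have e₁ : 6 * 1 / δ₁ = 6 * (d + 1) / ε * √q₁ ^ d := by rw [hδ₁]; field_simp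
    have e₂ : 6 * R / δ₂ = 6 * (d + 1) / ε * (R ^ (d - 1) * √q₂) := by
      rw [hδ₂, hL₂]
      field_simp
    rw [e₁] at hs₁card
    rw [e₂] at hs₂card
    rw [hTcard, Real.rpow_div_two_eq_sqrt _ (by positivity),
      Real.rpow_div_two_eq_sqrt _ (by positivity), Real.rpow_natCast, Real.rpow_natCast]
    calc _ ≤ (6 * (d + 1) / ε * √q₁ ^ d) ^ r ^ d *
          (((6 * (d + 1) / ε * (R ^ (d - 1) * √q₂)) ^ n) ^ r) ^ d := by gcongr
      _ = _ := by
        generalize 6 * ((d : ℝ) + 1) / ε = x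
        generalize d - 1 = d'
        simp only [mul_pow, ← pow_mul, pow_add]
        rw [show n * r * d = r * n * d by ring, show d * n * r = r * n * d by ring,
          show d' * n * r * d = d' * d * n * r by ring, mul_comm d (r ^ d)]
        ring
  calc (coveringNumber (BSetE d n r R μ θ) ε : ℝ≥0∞) ≤ ((T.card : ℕ∞) : ℝ≥0∞) :=
        ENat.toENNReal_le.2 hcov
    _ = ENNReal.ofReal T.card := by simp
    _ ≤ _ := ENNReal.ofReal_le_ofReal hbound

end
end
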